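/- For every ε > 0 there exists N such that for all n ≥ N the following holds: if A ⊆ {0,1}^n contains no non-trivial equilateral triangle (i.e., no three distinct points x, y, z ∈ A whose three pairwise Hamming distances are all equal), then |A| ≤ ((2/3)·Θ(C) + ε)^n, where Θ(C) is the capset capacity. -/

import Mathlib

/-- A capset in `(ZMod 3)^n`: no three elements, not all equal, summing to zero. -/
def IsCapset {n : ℕ} (S : Finset (Fin n → ZMod 3)) : Prop :=
  ∀ x ∈ S, ∀ y ∈ S, ∀ z ∈ S, x + y + z = 0 → x = y ∧ y = z

/-- `C_n`, the size of the largest capset in `(ZMod 3)^n`. -/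
noncomputable def capsetMax (n : ℕ) : ℕ :=
  sSup {k | ∃ S : Finset (Fin n → ZMod 3), IsCapset S ∧ S.card = k}

/-- The capset capacity `Θ(C) = limsup (C_n)^(1/n)`. -/
noncomputable def capsetCapacity : ℝ :=
  Filter.limsup (fun n : ℕ => (capsetMax n : ℝ) ^ ((1 : ℝ) / n)) Filter.atTop

open Finset Filter

theorem IsCapset.card_le_capsetMax {n : ℕ} {S : Finset (Fin n → ZMod 3)} (hS : IsCapset S) :
    S.card ≤ capsetMax n := by
  refine le_csSup ⟨3 ^ n, ?_⟩ ⟨S, hS, rfl⟩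
  rintro k ⟨T, -, rfl⟩
  simpa using card_le_univ T

theorem capsetMax_le (n : ℕ) : capsetMax n ≤ 3 ^ n := by
  refine csSup_le' ?_
  rintro k ⟨T, -, rfl⟩
  simpa using card_le_univ T

/-- The zero pattern of `v`, translated by `u` in the Boolean cube. -/
def shiftedZeroPattern {n : ℕ} (u : Fin n → Bool) (v : Fin n → ZMod 3) : Fin n → Bool :=
  fun i => xor (decide (v i = 0)) (u i)

theorem hammingDist_shiftedZeroPattern_add {n : ℕ} (u : Fin n → Bool) {x y z : Fin n → ZMod 3}
    (h : x + y + z = 0) :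
    hammingDist (shiftedZeroPattern u x) (shiftedZeroPattern u y) + #{i | z i = 0} =
      hammingDist (shiftedZeroPattern u y) (shiftedZeroPattern u z) + #{i | x i = 0} := by
  have key : ∀ (w : Bool) (a b c : ZMod 3), a + b + c = 0 →
      (if xor (decide (a = 0)) w ≠ xor (decide (b = 0)) w then 1 else 0) +
        (if c = 0 then 1 else 0) =
      (if xor (decide (b = 0)) w ≠ xor (decide (c = 0)) w then 1 else 0) +
        (if a = 0 then 1 else 0) := by decide
  simp only [hammingDist, card_filter, ← sum_add_distrib]
  exact sum_congr rfl fun i _ => key (u i) (x i) (y i) (z i) (congrFun h i)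

/-- Within a fixed number of zeros, vectors whose shifted zero pattern lies in an
equilateral-triangle-free set form a capset. -/
theorem isCapset_shiftedZeroPattern_preimage {n : ℕ} {A : Finset (Fin n → Bool)}
    (hA : ¬ ∃ x ∈ A, ∃ y ∈ A, ∃ z ∈ A, x ≠ y ∧ y ≠ z ∧ x ≠ z ∧
      hammingDist x y = hammingDist y z ∧ hammingDist y z = hammingDist z x)
    (u : Fin n → Bool) (k : ℕ) :
    IsCapset ({v | shiftedZeroPattern u v ∈ A ∧ #{i | v i = 0} = k} :
      Finset (Fin n → ZMod 3)) := by
  intro x hx y hy z hz h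
  simp only [mem_filter, mem_univ, true_and] at hx hy hz
  have h₁ := hammingDist_shiftedZeroPattern_add u h
  have h₂ := hammingDist_shiftedZeroPattern_add u (x := y) (y := z) (z := x)
    (by rw [← h]; abel)
  have hxy_yz : hammingDist (shiftedZeroPattern u x) (shiftedZeroPattern u y) =
    hammingDist (shiftedZeroPattern u y) (shiftedZeroPattern u z) := by omega
  have hyz_zx : hammingDist (shiftedZeroPattern u y) (shiftedZeroPattern u z) =
    hammingDist (shiftedZeroPattern u z) (shiftedZeroPattern u x) := by omega
  have hzero : hammingDist (shiftedZeroPattern u x) (shiftedZeroPattern u y) = 0 := by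
    by_contra hne
    refine hA ⟨_, hx.1, _, hy.1, _, hz.1, ?_, ?_, ?_, hxy_yz, hyz_zx⟩
    · exact hammingDist_ne_zero.1 hne
    · exact hammingDist_ne_zero.1 (hxy_yz ▸ hne)
    · exact (hammingDist_ne_zero.1 (hyz_zx ▸ hxy_yz ▸ hne)).symm
  have hxy := hammingDist_eq_zero.1 hzero
  have hyz := hammingDist_eq_zero.1 (hxy_yz ▸ hzero)
  have key : ∀ (w : Bool) (a b c : ZMod 3), a + b + c = 0 →
      xor (decide (a = 0)) w = xor (decide (b = 0)) w →
      xor (decide (b = 0)) w = xor (decide (c = 0)) w → a = b ∧ b = c := by decide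
  have hall i := key (u i) (x i) (y i) (z i) (congrFun h i) (congrFun hxy i) (congrFun hyz i)
  exact ⟨funext fun i => (hall i).1, funext fun i => (hall i).2⟩

theorem card_shift_mem {n : ℕ} (A : Finset (Fin n → Bool)) (v : Fin n → ZMod 3) :
    #{u | shiftedZeroPattern u v ∈ A} = #A := by
  have hinv : Function.Involutive fun u => shiftedZeroPattern u v := fun u => by
    funext i
    simp [shiftedZeroPattern]
  refine card_bij' (fun u _ => shiftedZeroPattern u v) (fun u _ => shiftedZeroPattern u v)
    ?_ ?_ ?_ ?_
  · intro u hu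
    exact (mem_filter.1 hu).2
  · intro u hu
    exact mem_filter.2 ⟨mem_univ _, by simpa only [hinv u] using hu⟩
  · exact fun u _ => hinv u
  · exact fun u _ => hinv u

theorem three_pow_mul_card_le {n : ℕ} {A : Finset (Fin n → Bool)}
    (hA : ¬ ∃ x ∈ A, ∃ y ∈ A, ∃ z ∈ A, x ≠ y ∧ y ≠ z ∧ x ≠ z ∧
      hammingDist x y = hammingDist y z ∧ hammingDist y z = hammingDist z x) :
    3 ^ n * #A ≤ 2 ^ n * ((n + 1) * capsetMax n) := by
  have hslice (u : Fin n → Bool) :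
      #{v : Fin n → ZMod 3 | shiftedZeroPattern u v ∈ A} ≤ (n + 1) * capsetMax n := by
    rw [card_eq_sum_card_fiberwise (f := fun v => #{i | v i = 0}) (t := range (n + 1))
      fun v _ => by
        have := card_le_univ ({i | v i = 0} : Finset (Fin n))
        simp only [Fintype.card_fin] at this
        simpa [Nat.lt_succ_iff] using this]
    calc _ ≤ ∑ _k ∈ range (n + 1), capsetMax n := sum_le_sum fun k _ => by
          rw [filter_filter]
          exact (isCapset_shiftedZeroPattern_preimage hA u k).card_le_capsetMax
      _ = _ := by simp
  calc 3 ^ n * #A = ∑ v : Fin n → ZMod 3, #{u | shiftedZeroPattern u v ∈ A} := by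
        simp [card_shift_mem]
    _ = ∑ u : Fin n → Bool, #{v : Fin n → ZMod 3 | shiftedZeroPattern u v ∈ A} := by
        simp only [card_filter]
        exact sum_comm
    _ ≤ ∑ _u : Fin n → Bool, (n + 1) * capsetMax n := sum_le_sum fun u _ => hslice u
    _ = _ := by simp

theorem eventually_capsetMax_rpow_lt {δ : ℝ} (hδ : 0 < δ) :
    ∀ᶠ n : ℕ in atTop, (capsetMax n : ℝ) ^ ((1 : ℝ) / n) < capsetCapacity + δ := by
  refine eventually_lt_of_limsup_lt (lt_add_of_pos_right capsetCapacity hδ) ?_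
  refine isBoundedUnder_of_eventually_le (a := 3) ?_
  filter_upwards [eventually_ne_atTop 0] with n hn
  calc (capsetMax n : ℝ) ^ ((1 : ℝ) / n) ≤ ((3 : ℝ) ^ n) ^ ((1 : ℝ) / n) := by
        gcongr
        exact_mod_cast capsetMax_le n
    _ = 3 := by rw [one_div, Real.pow_rpow_inv_natCast (by norm_num) hn]

theorem eventually_succ_mul_pow_le_pow {a b : ℝ} (ha : 0 < a) (hab : a < b) :
    ∀ᶠ n : ℕ in atTop, ((n : ℝ) + 1) * a ^ n ≤ b ^ n := by
  have hr₀ : 0 ≤ a / b := (div_pos ha (ha.trans hab)).le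
  have hr₁ : a / b < 1 := (div_lt_one (ha.trans hab)).2 hab
  have hlim := (tendsto_self_mul_const_pow_of_lt_one hr₀ hr₁).add
    (tendsto_pow_atTop_nhds_zero_of_lt_one hr₀ hr₁)
  rw [add_zero] at hlim
  filter_upwards [hlim.eventually_le_const one_pos] with n hn
  have hb : 0 < b ^ n := pow_pos (ha.trans hab) n
  rwa [div_pow, ← add_one_mul, ← mul_div_assoc, div_le_one hb] at hn

theorem equilateral_triangle_free_bound :
    ∀ ε : ℝ, 0 < ε → ∃ N : ℕ, ∀ n : ℕ, N ≤ n →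
      ∀ A : Finset (Fin n → Bool),
        (¬ ∃ x ∈ A, ∃ y ∈ A, ∃ z ∈ A, x ≠ y ∧ y ≠ z ∧ x ≠ z ∧
            hammingDist x y = hammingDist y z ∧ hammingDist y z = hammingDist z x) →
        (A.card : ℝ) ≤ ((2 / 3) * capsetCapacity + ε) ^ n := by
  intro ε hε
  have hcap := eventually_capsetMax_rpow_lt hε
  have hpos : 0 < capsetCapacity + ε := by
    obtain ⟨n, hn⟩ := hcap.exists
    exact (by positivity : (0 : ℝ) ≤ (capsetMax n : ℝ) ^ ((1 : ℝ) / n)).trans_lt hn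
  have hgrowth := eventually_succ_mul_pow_le_pow (a := 2 / 3 * (capsetCapacity + ε))
    (b := 2 / 3 * capsetCapacity + ε) (by positivity) (by linarith)
  refine eventually_atTop.1 ?_
  filter_upwards [hcap, hgrowth, eventually_ne_atTop 0] with n hn hgn hn0 A hA
  have hC : (capsetMax n : ℝ) ≤ (capsetCapacity + ε) ^ n := by
    rw [← Real.rpow_inv_natCast_pow (Nat.cast_nonneg (capsetMax n)) hn0, ← one_div]
    exact pow_le_pow_left₀ (by positivity) hn.le n
  have hcount : (3 : ℝ) ^ n * #A ≤ 2 ^ n * ((n + 1) * capsetMax n) := by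
    exact_mod_cast three_pow_mul_card_le hA
  refine le_trans ?_ hgn
  rw [mul_pow, div_pow]
  calc (#A : ℝ) ≤ 2 ^ n * ((n + 1) * capsetMax n) / 3 ^ n := by
        rw [le_div_iff₀ (by positivity), mul_comm]
        exact hcount
    _ ≤ 2 ^ n * ((n + 1) * (capsetCapacity + ε) ^ n) / 3 ^ n := by gcongr
    _ = _ := by ring
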